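/- A non-commutative association scheme with 5 classes cannot have a 4-class fusion scheme: if A_0, A_1, …, A_5 form an association scheme with 5 classes that is not commutative, then no admissible partition of {0,1,…,5} with exactly 5 blocks gives rise to a fusion scheme. -/

import Mathlib

open Matrix BigOperators

/-- An association scheme on `n` vertices, encoded as a family of `n × n`
real `0/1`-matrices indexed by `ι`: `e` is the index of the diagonal (identity)
relation and `σ` is the pairing sending each relation to its transpose.
All relations are nonempty, the identity relation is the identity matrix,
the relations partition `X × X` (the matrices sum to the all-ones matrix `J`),
the family is closed under transposition, and products of the matrices are
nonnegative-integer linear combinations of the matrices. -/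
def IsAssocScheme {ι : Type} [Fintype ι] (n : ℕ)
    (A : ι → Matrix (Fin n) (Fin n) ℝ) (e : ι) (σ : ι → ι) : Prop :=
  (∀ i, A i ≠ 0) ∧
  (∀ i x y, A i x y = 0 ∨ A i x y = 1) ∧
  A e = 1 ∧
  (∑ i, A i) = Matrix.of (fun _ _ => (1 : ℝ)) ∧
  (∀ i, (A i)ᵀ = A (σ i)) ∧
  (∀ i j, ∃ p : ι → ℕ, A i * A j = ∑ k, (p k : ℝ) • A k)

/-- `Λ` is a partition of the index set `ι`: its blocks are nonempty and every
index lies in exactly one block. -/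
def IsPartition {ι : Type} [Fintype ι] [DecidableEq ι]
    (Λ : Finset (Finset ι)) : Prop :=
  (∀ C ∈ Λ, C.Nonempty) ∧ ∀ i : ι, ∃! C, C ∈ Λ ∧ i ∈ C

/-- A partition `Λ` of the index set is admissible (for a scheme with diagonal
index `e` and transpose pairing `σ`) if `{e}` is a block of `Λ` and the image
of every block under the pairing `σ` is again a block. -/
def Admissible {ι : Type} [Fintype ι] [DecidableEq ι]
    (e : ι) (σ : ι → ι) (Λ : Finset (Finset ι)) : Prop :=
  ({e} : Finset ι) ∈ Λ ∧ ∀ C ∈ Λ, C.image σ ∈ Λ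

/-- The partition `Λ` gives rise to a fusion scheme: the block sums
`B_C = ∑_{i ∈ C} A_i`, indexed by the blocks of `Λ`, again form an
association scheme, with diagonal block `{e}`. -/
def GivesFusion {ι : Type} [Fintype ι] [DecidableEq ι] (n : ℕ)
    (A : ι → Matrix (Fin n) (Fin n) ℝ) (e : ι) (Λ : Finset (Finset ι)) : Prop :=
  ∃ (E : {C // C ∈ Λ}) (σ' : {C // C ∈ Λ} → {C // C ∈ Λ}),
    (E : Finset ι) = {e} ∧
    IsAssocScheme n (fun C : {C // C ∈ Λ} => ∑ i ∈ (C : Finset ι), A i) E σ'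

/-- The scheme is amorphous: every admissible partition of the index set gives
rise to a fusion scheme. -/
def Amorphous {ι : Type} [Fintype ι] [DecidableEq ι] (n : ℕ)
    (A : ι → Matrix (Fin n) (Fin n) ℝ) (e : ι) (σ : ι → ι) : Prop :=
  ∀ Λ : Finset (Finset ι), IsPartition Λ → Admissible e σ Λ → GivesFusion n A e Λ


/-- Nondegeneracy of the trace form. -/
lemma tr_self_ne {n : ℕ} {X : Matrix (Fin n) (Fin n) ℝ} (h : X ≠ 0) :
    trace (X * Xᵀ) ≠ 0 := by
  intro h0
  apply h
  have := Matrix.trace_mul_conjTranspose_self_eq_zero_iff (A := X)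
  rw [Matrix.conjTranspose_eq_transpose_of_trivial] at this
  exact this.1 h0

/-- A self-adjoint algebra of dimension at most six with a self-adjoint subalgebra of codimension
one containing `1` and `J` is commutative. -/
lemma core (n : ℕ) (J : Matrix (Fin n) (Fin n) ℝ) (V W : Submodule ℝ (Matrix (Fin n) (Fin n) ℝ))
    (hJT : Jᵀ = J) (hJtr : trace J ≠ 0)
    (mulV : ∀ X ∈ V, ∀ Y ∈ V, X * Y ∈ V) (mulW : ∀ X ∈ W, ∀ Y ∈ W, X * Y ∈ W)
    (tV : ∀ X ∈ V, Xᵀ ∈ V) (tW : ∀ X ∈ W, Xᵀ ∈ W)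
    (oneW : 1 ∈ W) (JW : J ∈ W) (hWV : W ≤ V) (hdim : Module.finrank ℝ V ≤ 6)
    (hJ : ∀ X ∈ V, ∃ r : ℝ, X * J = r • J)
    (D : Matrix (Fin n) (Fin n) ℝ) (DV : D ∈ V) (D0 : D ≠ 0)
    (hD : ∀ w ∈ W, trace (D * wᵀ) = 0)
    (perp : ∀ X ∈ V, (∀ w ∈ W, trace (X * wᵀ) = 0) → ∃ c : ℝ, X = c • D)
    (dec : ∀ X ∈ V, ∃ w ∈ W, ∃ c : ℝ, X = w + c • D) :
    ∀ X ∈ V, ∀ Y ∈ V, X * Y = Y * X := by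
  -- J central
  have hJ' : ∀ X ∈ V, ∃ r : ℝ, J * X = r • J := by
    intro X hX
    obtain ⟨r, hr⟩ := hJ _ (tV X hX)
    refine ⟨r, ?_⟩
    have := congrArg transpose hr
    simpa [Matrix.transpose_mul, hJT] using this
  have Jc : ∀ X ∈ V, X * J = J * X := by
    intro X hX
    obtain ⟨r, hr⟩ := hJ X hX
    obtain ⟨s, hs⟩ := hJ' X hX
    have h := Matrix.trace_mul_comm X J
    rw [hr, hs, trace_smul, trace_smul, smul_eq_mul, smul_eq_mul] at h
    rw [hr, hs, mul_right_cancel₀ hJtr h]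
  -- D is a two-sided eigenvector
  have lam : ∀ b ∈ W, ∃ c : ℝ, b * D = c • D := by
    intro b hb
    apply perp _ (mulV _ (hWV hb) _ DV)
    intro w hw
    have h := hD _ (mulW _ (tW b hb) _ hw)
    rw [Matrix.transpose_mul, transpose_transpose, ← mul_assoc, Matrix.trace_mul_comm,
      ← mul_assoc] at h
    exact h
  have rho : ∀ b ∈ W, ∃ c : ℝ, D * b = c • D := by
    intro b hb
    apply perp _ (mulV _ DV _ (hWV hb))
    intro w hw
    have h := hD _ (mulW _ hw _ (tW b hb))
    rw [Matrix.transpose_mul, transpose_transpose, ← mul_assoc] at h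
    exact h
  have DT : ∃ c : ℝ, Dᵀ = c • D := by
    apply perp _ (tV _ DV)
    intro w hw
    have h := hD _ (tW w hw)
    rw [← Matrix.trace_transpose, Matrix.transpose_mul, transpose_transpose,
      transpose_transpose, Matrix.trace_mul_comm]
    rw [transpose_transpose, Matrix.trace_mul_comm] at h
    rw [Matrix.trace_mul_comm]; exact h
  have trDD : trace (D * D) ≠ 0 := by
    obtain ⟨c, hc⟩ := DT
    have h := tr_self_ne D0
    rw [hc, Matrix.mul_smul, trace_smul] at h
    exact fun h0 => h (by rw [h0, smul_zero])
  have DD0 : D * D ≠ 0 := fun h => trDD (by rw [h, trace_zero])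
  have trD : trace D = 0 := by simpa using hD 1 oneW
  have com : ∀ b ∈ W, ∃ c : ℝ, b * D = c • D ∧ D * b = c • D := by
    intro b hb
    obtain ⟨c, hc⟩ := lam b hb
    obtain ⟨d, hd⟩ := rho b hb
    have h : D * b * D = D * (b * D) := mul_assoc _ _ _
    rw [hc, hd, Matrix.smul_mul, Matrix.mul_smul] at h
    have := smul_left_injective ℝ DD0 h
    exact ⟨c, hc, by rw [hd]; exact congrArg (· • D) this⟩
  have Dc : ∀ X ∈ V, X * D = D * X := by
    intro X hX
    obtain ⟨w, hw, c, rfl⟩ := dec X hX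
    obtain ⟨e, h1, h2⟩ := com w hw
    rw [add_mul, mul_add, h1, h2, Matrix.smul_mul, Matrix.mul_smul]
  have D2c : ∀ X ∈ V, X * (D * D) = (D * D) * X := by
    intro X hX
    rw [← mul_assoc, Dc X hX, mul_assoc, Dc X hX, mul_assoc]
  have JD : J * D = 0 := by
    obtain ⟨r, hr⟩ := hJ' D DV
    have h := hD J JW
    rw [hJT, Matrix.trace_mul_comm, hr, trace_smul, smul_eq_mul] at h
    rw [hr, (mul_eq_zero.1 h).resolve_right hJtr, zero_smul]
  -- suppose not commutative
  by_contra hnc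
  push Not at hnc
  obtain ⟨x, hx, y, hy, hxy⟩ := hnc
  have z0 : x * y - y * x ≠ 0 := sub_ne_zero.2 hxy
  have oneV := hWV oneW
  have JV := hWV JW
  -- W is not contained in the span of 1 and J
  have Wnc : ¬ ∀ w ∈ W, ∃ a b : ℝ, w = a • (1 : Matrix (Fin n) (Fin n) ℝ) + b • J := by
    intro h
    have key : ∀ X ∈ V, ∀ Y ∈ V, X * Y = Y * X := by
      intro X hX Y hY
      obtain ⟨w, hw, c, rfl⟩ := dec X hX
      obtain ⟨a, b, rfl⟩ := h w hw
      simp only [add_mul, mul_add, Matrix.smul_mul, Matrix.mul_smul, one_mul, mul_one,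
        Jc Y hY, Dc Y hY]
    exact hxy (key x hx y hy)
  -- independence of the four central elements
  have indep : ∀ α β γ δ : ℝ, α • (1 : Matrix (Fin n) (Fin n) ℝ) + β • J + γ • D + δ • (D * D) = 0 →
      α = 0 ∧ β = 0 ∧ γ = 0 ∧ δ = 0 := by
    intro α β γ δ h
    have hα : α = 0 := by
      by_contra hα
      apply Wnc
      intro w hw
      obtain ⟨k, hk⟩ := hJ w (hWV hw)
      obtain ⟨l, hl, -⟩ := com w hw
      have h1 : w * (α • (1 : Matrix (Fin n) (Fin n) ℝ) + β • J + γ • D + δ • (D * D))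
        = l • (α • (1 : Matrix (Fin n) (Fin n) ℝ) + β • J + γ • D + δ • (D * D)) := by
        rw [h]; simp
      simp only [mul_add, Matrix.mul_smul, mul_one, ← mul_assoc, hk, hl, Matrix.smul_mul] at h1
      refine ⟨l, α⁻¹ * (l * β - β * k), ?_⟩
      have h2 : α • w = (α * l) • (1 : Matrix (Fin n) (Fin n) ℝ) + (l * β - β * k) • J := by
        rw [← sub_eq_zero] at h1 ⊢
        rw [← h1]
        module
      have h3 : w = α⁻¹ • (α • w) := by rw [smul_smul, inv_mul_cancel₀ hα, one_smul]
      rw [h3, h2, smul_add, smul_smul, smul_smul, inv_mul_cancel_left₀ hα]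
    subst hα
    have hβ : β = 0 := by
      have h1 := congrArg (fun M => trace (J * M)) h
      simp only [zero_smul, zero_add, mul_add, Matrix.mul_smul, ← mul_assoc, JD, zero_mul,
        smul_zero, add_zero, mul_zero, trace_zero, trace_smul, smul_eq_mul] at h1
      refine (mul_eq_zero.1 h1).resolve_right ?_
      have := tr_self_ne (X := J) (by rintro rfl; simp at hJtr)
      rwa [hJT] at this
    subst hβ
    have hδ : δ = 0 := by
      have h1 := congrArg trace h
      simp only [zero_smul, zero_add, trace_add, trace_smul, trD, mul_zero, trace_zero,
        smul_eq_mul] at h1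
      exact (mul_eq_zero.1 h1).resolve_right trDD
    subst hδ
    refine ⟨rfl, rfl, ?_, rfl⟩
    simp only [zero_smul, zero_add, add_zero] at h
    exact (smul_eq_zero.1 h).resolve_right D0
  -- commutators with central elements
  have brx : ∀ α β γ δ ξ η : ℝ,
      x * (α • (1 : Matrix (Fin n) (Fin n) ℝ) + β • J + γ • D + δ • (D * D) + ξ • x + η • y)
      - (α • (1 : Matrix (Fin n) (Fin n) ℝ) + β • J + γ • D + δ • (D * D) + ξ • x + η • y) * x
      = η • (x * y - y * x) := by
    intro α β γ δ ξ η
    simp only [mul_add, add_mul, Matrix.smul_mul, Matrix.mul_smul, Jc x hx, Dc x hx, D2c x hx,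
      mul_one, one_mul]
    module
  have bry : ∀ α β γ δ ξ η : ℝ,
      (α • (1 : Matrix (Fin n) (Fin n) ℝ) + β • J + γ • D + δ • (D * D) + ξ • x + η • y) * y
      - y * (α • (1 : Matrix (Fin n) (Fin n) ℝ) + β • J + γ • D + δ • (D * D) + ξ • x + η • y)
      = ξ • (x * y - y * x) := by
    intro α β γ δ ξ η
    simp only [mul_add, add_mul, Matrix.smul_mul, Matrix.mul_smul, Jc y hy, Dc y hy, D2c y hy,
      mul_one, one_mul]
    module
  let f : Fin 6 → V := ![⟨1, oneV⟩, ⟨J, JV⟩, ⟨D, DV⟩, ⟨D * D, mulV _ DV _ DV⟩, ⟨x, hx⟩, ⟨y, hy⟩]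
  have hf : LinearIndependent ℝ f := by
    rw [Fintype.linearIndependent_iff]
    intro g hg
    have hg' := congrArg (Subtype.val) hg
    simp [Fin.sum_univ_succ, f] at hg'
    have hg2 : g 0 • (1 : Matrix (Fin n) (Fin n) ℝ) + g 1 • J + g 2 • D + g 3 • (D * D)
        + g 4 • x + g 5 • y = 0 := by
      rw [← hg']
      simp only [add_assoc]
    have e5 := brx (g 0) (g 1) (g 2) (g 3) (g 4) (g 5)
    have e4 := bry (g 0) (g 1) (g 2) (g 3) (g 4) (g 5)
    rw [hg2] at e5 e4
    simp only [mul_zero, zero_mul, sub_zero] at e5 e4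
    have h5 := (smul_eq_zero.1 e5.symm).resolve_right z0
    have h4 := (smul_eq_zero.1 e4.symm).resolve_right z0
    rw [h4, h5, zero_smul, zero_smul, add_zero, add_zero] at hg2
    obtain ⟨h0, h1, h2, h3⟩ := indep _ _ _ _ hg2
    intro i
    fin_cases i <;> assumption
  have hcard : Module.finrank ℝ V = 6 :=
    le_antisymm hdim (by simpa using hf.fintype_card_le_finrank)
  have hspan : Submodule.span ℝ (Set.range f) = ⊤ :=
    hf.span_eq_top_of_card_eq_finrank' (by simp [hcard])
  have gen : ∀ v ∈ V, ∃ α β γ δ ξ η : ℝ,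
      v = α • (1 : Matrix (Fin n) (Fin n) ℝ) + β • J + γ • D + δ • (D * D) + ξ • x + η • y := by
    intro v hv
    have : (⟨v, hv⟩ : V) ∈ Submodule.span ℝ (Set.range f) := by rw [hspan]; trivial
    obtain ⟨g, hg⟩ := (Submodule.mem_span_range_iff_exists_fun ℝ).1 this
    have hg' := congrArg (Subtype.val) hg
    simp [Fin.sum_univ_succ, f] at hg'
    refine ⟨g 0, g 1, g 2, g 3, g 4, g 5, ?_⟩
    rw [← hg']
    simp only [add_assoc]
  have brk : ∀ u ∈ V, ∀ v ∈ V, ∃ c : ℝ, u * v - v * u = c • (x * y - y * x) := by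
    intro u hu v hv
    obtain ⟨α, β, γ, δ, ξ, η, rfl⟩ := gen u hu
    obtain ⟨a, b, c, d, s, t, rfl⟩ := gen v hv
    refine ⟨ξ * t - η * s, ?_⟩
    have hv1 := brx a b c d s t
    have hv2 := bry a b c d s t
    set v := a • (1 : Matrix (Fin n) (Fin n) ℝ) + b • J + c • D + d • (D * D) + s • x + t • y
    have h1 : x * v = t • (x * y - y * x) + v * x := by rw [← hv1]; abel
    have h2 : y * v = v * y - s • (x * y - y * x) := by rw [← hv2]; abel
    simp only [mul_add, add_mul, Matrix.smul_mul, Matrix.mul_smul, ← Jc v hv, ← Dc v hv,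
      ← D2c v hv, mul_one, one_mul, h1, h2]
    module
  have hz : x * y - y * x ∈ V := V.sub_mem (mulV _ hx _ hy) (mulV _ hy _ hx)
  obtain ⟨ε, hε⟩ := brk yᵀ (tV y hy) xᵀ (tV x hx)
  have zT : (x * y - y * x)ᵀ = ε • (x * y - y * x) := by
    rw [← hε, transpose_sub, transpose_mul, transpose_mul]
  obtain ⟨μ, hμ⟩ := brk x hx _ hz
  set z := x * y - y * x with hzdef
  have trz : trace (z * z) ≠ 0 := by
    have h := tr_self_ne z0
    rw [zT, Matrix.mul_smul, trace_smul] at h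
    exact fun h0 => h (by rw [h0, smul_zero])
  have hμ0 : μ = 0 := by
    have h := congrArg (fun M => trace (M * z)) hμ
    simp only [sub_mul, trace_sub, Matrix.smul_mul, trace_smul, smul_eq_mul] at h
    rw [Matrix.trace_mul_comm (x * z) z, ← mul_assoc, sub_self] at h
    exact (mul_eq_zero.1 h.symm).resolve_right trz
  rw [hμ0, zero_smul, sub_eq_zero] at hμ
  apply trz
  have : z * z = x * y * z - y * z * x := by
    rw [mul_assoc y z x, ← hμ, ← mul_assoc, ← sub_mul]
  rw [this, trace_sub, Matrix.trace_mul_comm (y * z) x, ← mul_assoc, sub_self]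

/-- A partition of six indices into five blocks has exactly one block of size two. -/
lemma five_blocks (Λ : Finset (Finset (Fin 6))) (hp : IsPartition Λ) (hc : Λ.card = 5) :
    ∃ a b : Fin 6, a ≠ b ∧ ({a, b} : Finset (Fin 6)) ∈ Λ ∧
      (∀ c, c ≠ a → c ≠ b → ({c} : Finset (Fin 6)) ∈ Λ) ∧
      (∀ C ∈ Λ, a ∈ C ↔ b ∈ C) := by
  obtain ⟨hne, hu⟩ := hp
  choose f hf hfu using hu
  have hfu' : ∀ i, ∀ C ∈ Λ, i ∈ C → C = f i := fun i C h1 h2 => hfu i C ⟨h1, h2⟩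
  have hmem : ∀ i j, j ∈ f i ↔ f j = f i := by
    intro i j
    constructor
    · intro h; exact (hfu' j _ (hf i).1 h).symm
    · intro h; rw [← h]; exact (hf j).2
  obtain ⟨a, -, b, -, hab, hfab⟩ := Finset.exists_ne_map_eq_of_card_lt_of_maps_to
    (s := (Finset.univ : Finset (Fin 6))) (t := Λ) (by simp [hc]) (f := f)
    (fun i _ => (hf i).1)
  have himg : (Finset.univ.erase a).image f = Λ := by
    apply Finset.Subset.antisymm
    · intro C hC
      obtain ⟨i, -, rfl⟩ := Finset.mem_image.1 hC
      exact (hf i).1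
    · intro C hC
      obtain ⟨i, hi⟩ := hne C hC
      have hCi := hfu' i C hC hi
      by_cases hia : i = a
      · subst hia
        exact Finset.mem_image.2 ⟨b, by simp [hab.symm], by rw [hCi, hfab]⟩
      · exact Finset.mem_image.2 ⟨i, by simp [hia], hCi.symm⟩
  have hinj : Set.InjOn f (Finset.univ.erase a : Finset (Fin 6)) := by
    apply Finset.card_image_iff.1
    rw [himg, hc]
    simp
  have hinj' : ∀ i j, i ≠ a → j ≠ a → f i = f j → i = j := fun i j hi hj h =>
    hinj (by simp [hi]) (by simp [hj]) h
  refine ⟨a, b, hab, ?_, ?_, ?_⟩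
  · have : ({a, b} : Finset (Fin 6)) = f a := by
      ext j
      rw [hmem, Finset.mem_insert, Finset.mem_singleton]
      constructor
      · rintro (rfl | rfl)
        · rfl
        · exact hfab.symm
      · intro h
        by_cases hj : j = a
        · exact Or.inl hj
        · exact Or.inr (hinj' j b hj hab.symm (h.trans hfab))
    rw [this]; exact (hf a).1
  · intro c hca hcb
    have : ({c} : Finset (Fin 6)) = f c := by
      ext j
      rw [hmem, Finset.mem_singleton]
      constructor
      · rintro rfl; rfl
      · intro h
        by_cases hj : j = a
        · subst hj
          exact absurd (hinj' b c hab.symm hca (hfab.symm.trans h)).symm hcb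
        · exact hinj' j c hj hca h
    rw [this]; exact (hf c).1
  · intro C hC
    constructor
    · intro h
      rw [hfu' a C hC h, hfab]; exact (hf b).2
    · intro h
      rw [hfu' b C hC h, ← hfab]; exact (hf a).2

/-- The span of an association scheme is closed under products. -/
lemma span_mul {ι : Type} [Fintype ι] {n : ℕ} {A : ι → Matrix (Fin n) (Fin n) ℝ} {e : ι}
    {σ : ι → ι} (hA : IsAssocScheme n A e σ) :
    ∀ X ∈ Submodule.span ℝ (Set.range A), ∀ Y ∈ Submodule.span ℝ (Set.range A),
      X * Y ∈ Submodule.span ℝ (Set.range A) := by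
  obtain ⟨-, -, -, -, -, hmul⟩ := hA
  intro X hX Y hY
  obtain ⟨g, rfl⟩ := (Submodule.mem_span_range_iff_exists_fun ℝ).1 hX
  obtain ⟨h, rfl⟩ := (Submodule.mem_span_range_iff_exists_fun ℝ).1 hY
  rw [Finset.sum_mul_sum]
  refine Submodule.sum_mem _ fun i _ => Submodule.sum_mem _ fun j _ => ?_
  rw [Matrix.smul_mul, Matrix.mul_smul]
  refine Submodule.smul_mem _ _ (Submodule.smul_mem _ _ ?_)
  obtain ⟨p, hp⟩ := hmul i j
  rw [hp]
  exact Submodule.sum_mem _ fun k _ => Submodule.smul_mem _ _ (Submodule.subset_span ⟨k, rfl⟩)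

/-- The span of an association scheme is closed under transposition. -/
lemma span_transpose {ι : Type} [Fintype ι] {n : ℕ} {A : ι → Matrix (Fin n) (Fin n) ℝ} {e : ι}
    {σ : ι → ι} (hA : IsAssocScheme n A e σ) :
    ∀ X ∈ Submodule.span ℝ (Set.range A), Xᵀ ∈ Submodule.span ℝ (Set.range A) := by
  obtain ⟨-, -, -, -, ht, -⟩ := hA
  intro X hX
  obtain ⟨g, rfl⟩ := (Submodule.mem_span_range_iff_exists_fun ℝ).1 hX
  rw [Matrix.transpose_sum]
  refine Submodule.sum_mem _ fun i _ => ?_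
  rw [Matrix.transpose_smul, ht]
  exact Submodule.smul_mem _ _ (Submodule.subset_span ⟨_, rfl⟩)

/-- Distinct relations are disjoint. -/
lemma disj {ι : Type} [Fintype ι] {n : ℕ} {A : ι → Matrix (Fin n) (Fin n) ℝ} {e : ι}
    {σ : ι → ι} (hA : IsAssocScheme n A e σ) (i j : ι) (hij : i ≠ j) (x y : Fin n) :
    A i x y * A j x y = 0 := by
  classical
  obtain ⟨-, h01, -, hs, -, -⟩ := hA
  have h1 : ∑ k, A k x y = 1 := by
    have := congrFun (congrFun hs x) y
    rwa [Matrix.sum_apply] at this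
  have h2 : ∑ k ∈ {i, j}, A k x y ≤ ∑ k, A k x y := by
    apply Finset.sum_le_sum_of_subset_of_nonneg (Finset.subset_univ _)
    intro k _ _
    rcases h01 k x y with h | h <;> rw [h] <;> norm_num
  rw [Finset.sum_pair hij, h1] at h2
  rcases h01 i x y with h | h
  · rw [h, zero_mul]
  · rcases h01 j x y with h' | h'
    · rw [h', mul_zero]
    · rw [h, h'] at h2
      norm_num at h2

lemma orth {ι : Type} [Fintype ι] {n : ℕ} {A : ι → Matrix (Fin n) (Fin n) ℝ} {e : ι}
    {σ : ι → ι} (hA : IsAssocScheme n A e σ) (i j : ι) (hij : i ≠ j) :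
    trace (A i * (A j)ᵀ) = 0 := by
  simp only [Matrix.trace, Matrix.diag, Matrix.mul_apply, Matrix.transpose_apply]
  exact Finset.sum_eq_zero fun x _ => Finset.sum_eq_zero fun y _ => disj hA i j hij x y

/-- Row sums are constant. -/
lemma rowsum {ι : Type} [Fintype ι] {n : ℕ} {A : ι → Matrix (Fin n) (Fin n) ℝ} {e : ι}
    {σ : ι → ι} (hA : IsAssocScheme n A e σ) (i : ι) :
    ∃ r : ℝ, A i * Matrix.of (fun _ _ => (1 : ℝ)) = r • Matrix.of (fun _ _ => (1 : ℝ)) := by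
  classical
  have hd := disj hA
  obtain ⟨-, h01, h1, hs, ht, hmul⟩ := hA
  obtain ⟨p, hp⟩ := hmul i (σ i)
  refine ⟨p e, ?_⟩
  ext x y
  have h := congrFun (congrFun hp x) x
  rw [← ht, Matrix.sum_apply, Finset.sum_eq_single e] at h
  · simp only [Matrix.mul_apply, Matrix.transpose_apply, Matrix.smul_apply, h1,
      Matrix.one_apply_eq, Matrix.of_apply, smul_eq_mul, mul_one] at h ⊢
    rw [← h]
    refine Finset.sum_congr rfl fun z _ => ?_
    rcases h01 i x z with h | h <;> rw [h] <;> norm_num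
  · intro k _ hk
    have := hd k e hk x x
    rw [h1, Matrix.one_apply_eq, mul_one] at this
    rw [Matrix.smul_apply, this, smul_zero]
  · simp

/-- A non-commutative association scheme with 5 classes cannot have a 4-class
fusion scheme: no admissible partition of the index set `{0, 1, …, 5}` with
exactly 5 blocks gives rise to a fusion scheme. -/
theorem noncommutative_five_class_has_no_four_class_fusion
    (n : ℕ)
    (A : Fin 6 → Matrix (Fin n) (Fin n) ℝ) (σ : Fin 6 → Fin 6)
    (hA : IsAssocScheme n A 0 σ)
    (hnc : ¬ ∀ i j, A i * A j = A j * A i) :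
    ∀ Λ : Finset (Finset (Fin 6)), IsPartition Λ → Admissible 0 σ Λ →
      Λ.card = 5 → ¬ GivesFusion n A 0 Λ := by
  intro Λ hP _ hcard hF
  obtain ⟨a, b, hab, habΛ, hsing, hiff⟩ := five_blocks Λ hP hcard
  obtain ⟨E, σ', hE, hB⟩ := hF
  apply hnc
  set V := Submodule.span ℝ (Set.range A) with hV
  set W := Submodule.span ℝ
    (Set.range (fun C : {C // C ∈ Λ} => ∑ i ∈ (C : Finset (Fin 6)), A i)) with hW
  have AV : ∀ i, A i ∈ V := fun i => Submodule.subset_span ⟨i, rfl⟩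
  have hWV : W ≤ V := by
    rw [hW, Submodule.span_le]
    rintro _ ⟨C, rfl⟩
    exact Submodule.sum_mem _ fun i _ => AV i
  have AW : ∀ c, c ≠ a → c ≠ b → A c ∈ W := fun c h1 h2 =>
    Submodule.subset_span ⟨⟨{c}, hsing c h1 h2⟩, by simp⟩
  have abW : A a + A b ∈ W :=
    Submodule.subset_span ⟨⟨{a, b}, habΛ⟩, by simp [Finset.sum_pair hab]⟩
  have oneW : (1 : Matrix (Fin n) (Fin n) ℝ) ∈ W := by
    rw [← hB.2.2.1]; exact Submodule.subset_span ⟨E, rfl⟩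
  have JW : (Matrix.of (fun _ _ => (1 : ℝ)) : Matrix (Fin n) (Fin n) ℝ) ∈ W := by
    rw [← hB.2.2.2.1]
    exact Submodule.sum_mem _ fun C _ => Submodule.subset_span ⟨C, rfl⟩
  have ho := orth hA
  have s0 : ∀ i, trace (A i * (A i)ᵀ) ≠ 0 := fun i => tr_self_ne (hA.1 i)
  have spos : ∀ i, 0 < trace (A i * (A i)ᵀ) := by
    intro i
    refine lt_of_le_of_ne ?_ (s0 i).symm
    simp only [Matrix.trace, Matrix.diag, Matrix.mul_apply, Matrix.transpose_apply]
    exact Finset.sum_nonneg fun x _ => Finset.sum_nonneg fun y _ => mul_self_nonneg _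
  set s : Fin 6 → ℝ := fun i => trace (A i * (A i)ᵀ) with hs
  -- inner products of a general element with the generators
  have coef : ∀ (g : Fin 6 → ℝ) (j : Fin 6), trace ((∑ i, g i • A i) * (A j)ᵀ) = g j * s j := by
    intro g j
    rw [Finset.sum_mul, Matrix.trace_sum, Finset.sum_eq_single j]
    · rw [Matrix.smul_mul, trace_smul, smul_eq_mul]
    · intro i _ hij
      rw [Matrix.smul_mul, trace_smul, ho i j hij, smul_zero]
    · simp
  have n0 : n ≠ 0 := by
    rintro rfl
    exact hA.1 0 (by ext x; exact x.elim0)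
  have hfin : Module.finrank ℝ V ≤ 6 := by
    have h := finrank_range_le_card (R := ℝ) A
    rw [Fintype.card_fin] at h
    exact h
  have hsab : s a + s b ≠ 0 := (add_pos (spos a) (spos b)).ne'
  have main := core n (Matrix.of (fun _ _ => (1 : ℝ))) V W (by ext; rfl)
    (by simp [Matrix.trace, n0]) (span_mul hA) (span_mul hB) (span_transpose hA)
    (span_transpose hB) oneW JW hWV hfin ?_ (s b • A a - s a • A b)
    (V.sub_mem (V.smul_mem _ (AV a)) (V.smul_mem _ (AV b))) ?_ ?_ ?_ ?_
  · intro i j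
    exact main _ (AV i) _ (AV j)
  · intro X hX
    obtain ⟨g, rfl⟩ := (Submodule.mem_span_range_iff_exists_fun ℝ).1 hX
    choose r hr using rowsum hA
    refine ⟨∑ i, g i * r i, ?_⟩
    rw [Finset.sum_mul, Finset.sum_smul]
    exact Finset.sum_congr rfl fun i _ => by rw [Matrix.smul_mul, hr, smul_smul]
  · intro h
    have h1 := congrArg (fun M => trace (M * (A a)ᵀ)) h
    simp only [sub_mul, Matrix.smul_mul, trace_sub, trace_smul, ho b a hab.symm, mul_zero,
      sub_zero, zero_mul, trace_zero, smul_eq_mul] at h1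
    exact mul_ne_zero (s0 b) (s0 a) h1
  · intro w hw
    obtain ⟨g, rfl⟩ := (Submodule.mem_span_range_iff_exists_fun ℝ).1 hw
    rw [Matrix.transpose_sum, Finset.mul_sum, Matrix.trace_sum]
    refine Finset.sum_eq_zero fun C _ => ?_
    rw [Matrix.transpose_smul, Matrix.mul_smul, trace_smul]
    have key : ∀ k, trace (A k * (∑ i ∈ (C : Finset (Fin 6)), A i)ᵀ)
        = if k ∈ (C : Finset (Fin 6)) then s k else 0 := by
      intro k
      rw [Matrix.transpose_sum, Finset.mul_sum, Matrix.trace_sum]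
      split_ifs with hk
      · rw [Finset.sum_eq_single_of_mem k hk]
        intro i _ hi
        exact ho k i hi.symm
      · exact Finset.sum_eq_zero fun i hi => ho k i (by rintro rfl; exact hk hi)
    rw [sub_mul, trace_sub, Matrix.smul_mul, Matrix.smul_mul, trace_smul, trace_smul, key, key]
    by_cases h : a ∈ (C : Finset (Fin 6))
    · rw [if_pos h, if_pos ((hiff C C.2).1 h)]
      simp only [smul_eq_mul]; ring
    · rw [if_neg h, if_neg (fun h' => h ((hiff C C.2).2 h'))]
      simp
  · intro X hX hperp
    obtain ⟨g, rfl⟩ := (Submodule.mem_span_range_iff_exists_fun ℝ).1 hX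
    have h0 : ∀ c, c ≠ a → c ≠ b → g c = 0 := by
      intro c h1 h2
      have := hperp _ (AW c h1 h2)
      rw [coef] at this
      exact (mul_eq_zero.1 this).resolve_right (s0 c)
    have h1 : g a * s a + g b * s b = 0 := by
      have := hperp _ abW
      rwa [Matrix.transpose_add, mul_add, trace_add, coef, coef] at this
    refine ⟨g a / s b, ?_⟩
    have hsub : ∑ i, g i • A i = ∑ i ∈ ({a, b} : Finset (Fin 6)), g i • A i := by
      symm
      apply Finset.sum_subset (Finset.subset_univ _)
      intro c _ hc
      simp only [Finset.mem_insert, Finset.mem_singleton, not_or] at hc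
      rw [h0 c hc.1 hc.2, zero_smul]
    have hb : s b ≠ 0 := s0 b
    have e1 : g a / s b * s b = g a := by field_simp
    have e2 : g a / s b * s a = - g b := by field_simp; linarith
    rw [hsub, Finset.sum_pair hab, smul_sub, smul_smul, smul_smul, e1, e2]
    module
  · have good : ∀ i, ∃ w ∈ W, ∃ c : ℝ, A i = w + c • (s b • A a - s a • A b) := by
      intro i
      by_cases ha : i = a
      · subst ha
        refine ⟨(s i / (s i + s b)) • (A i + A b), W.smul_mem _ abW, 1 / (s i + s b), ?_⟩
        have : A i = (s i / (s i + s b) + 1 / (s i + s b) * s b) • A i := by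
          rw [show s i / (s i + s b) + 1 / (s i + s b) * s b = 1 by field_simp, one_smul]
        nth_rewrite 1 [this]
        match_scalars <;> field_simp <;> ring
      · by_cases hb : i = b
        · subst hb
          refine ⟨(s i / (s a + s i)) • (A a + A i), W.smul_mem _ abW, -1 / (s a + s i), ?_⟩
          match_scalars <;> field_simp <;> ring
        · exact ⟨A i, AW i ha hb, 0, by simp⟩
    choose w hw c hc using good
    intro X hX
    obtain ⟨g, rfl⟩ := (Submodule.mem_span_range_iff_exists_fun ℝ).1 hX
    refine ⟨∑ i, g i • w i, W.sum_mem fun i _ => W.smul_mem _ (hw i), ∑ i, g i * c i, ?_⟩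
    rw [Finset.sum_smul, ← Finset.sum_add_distrib]
    refine Finset.sum_congr rfl fun i _ => ?_
    rw [mul_smul, ← smul_add, ← hc]
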